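/- Let q ≥ 3 and let G = Z_2 * Z_q = ⟨S⟩ * ⟨R⟩. Let X be a normal subgroup of finite index d containing S. Then the quotient G/X is cyclic, generated by the image of R, and X is isomorphic to a free product of d copies of Z_2 if d = q, or to a free product of Z_{q/d} and d copies of Z_2 if d is a proper divisor of q. -/

import Mathlib

/-- The Hecke group `G_q`, abstractly: the free product `Z_2 * Z_q`. -/
def Hecke (q : ℕ) : Type := Monoid.Coprod (Multiplicative (ZMod 2)) (Multiplicative (ZMod q))

instance (q : ℕ) : Group (Hecke q) :=
  inferInstanceAs (Group (Monoid.Coprod (Multiplicative (ZMod 2)) (Multiplicative (ZMod q))))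

/-- The order-2 generator `S`. -/
def HS (q : ℕ) : Hecke q := Monoid.Coprod.inl (Multiplicative.ofAdd (1 : ZMod 2))

/-- The order-`q` generator `R`. -/
def HR (q : ℕ) : Hecke q := Monoid.Coprod.inr (Multiplicative.ofAdd (1 : ZMod q))

open Monoid

section Kurosh

variable {A C : Type} [Group A] [Group C] (K : Subgroup C)

/-- A section of `C → C ⧸ K` sending the trivial coset to `1`. -/
noncomputable def kt (x : C ⧸ K) : C := x.out * (((1 : C) : C ⧸ K).out)⁻¹

lemma kt_one : kt K ((1 : C) : C ⧸ K) = 1 := by simp [kt]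

lemma kt_mk (x : C ⧸ K) : ((kt K x : C) : C ⧸ K) = x := by
  have h : (((1 : C) : C ⧸ K).out)⁻¹ ∈ K := by
    have := QuotientGroup.out_eq' ((1 : C) : C ⧸ K)
    have h2 := QuotientGroup.eq.1 this
    simpa using h2
  unfold kt
  rw [QuotientGroup.mk_mul_of_mem _ h]
  exact QuotientGroup.out_eq' x

lemma kt_smul_one (x : C ⧸ K) : kt K x • ((1 : C) : C ⧸ K) = x := by
  rw [MulAction.Quotient.smul_coe]
  simpa using kt_mk K x

lemma kcoc_mem (c : C) (x : C ⧸ K) : (kt K (c • x))⁻¹ * (c * kt K x) ∈ K := by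
  rw [← QuotientGroup.eq, kt_mk]
  conv_lhs => rw [← kt_mk K x]
  rfl

/-- The cocycle. -/
noncomputable def kcoc (c : C) (x : C ⧸ K) : K := ⟨_, kcoc_mem K c x⟩

variable (A) in
/-- The free product expected as the isomorphism type. -/
abbrev KH : Type := Coprod K (CoprodI (fun _ : C ⧸ K => A))

/-- The induced action of `C`. -/
noncomputable def kactC : C →* Equiv.Perm ((C ⧸ K) × KH A K) :=
  @MulAction.toPermHom C ((C ⧸ K) × KH A K) _
    { smul := fun c p => (c • p.1, Coprod.inl (kcoc K c p.1) * p.2)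
      one_smul := by
        rintro ⟨x, h⟩
        refine Prod.ext (one_smul _ _) ?_
        have : kcoc K 1 x = 1 := Subtype.ext (by simp [kcoc])
        change Coprod.inl (kcoc K 1 x) * h = h
        simp [this]
      mul_smul := by
        rintro c c' ⟨x, h⟩
        refine Prod.ext (mul_smul _ _ _) ?_
        have : kcoc K (c * c') x = kcoc K c (c' • x) * kcoc K c' x :=
          Subtype.ext (by simp [kcoc, mul_smul, mul_assoc])
        change Coprod.inl (kcoc K (c * c') x) * h =
          Coprod.inl (kcoc K c (c' • x)) * (Coprod.inl (kcoc K c' x) * h)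
        rw [this, map_mul, mul_assoc] }

lemma kactC_apply (c : C) (x : C ⧸ K) (h : KH A K) :
    kactC K c (x, h) = (c • x, Coprod.inl (kcoc K c x) * h) := rfl

/-- The induced action of `A`. -/
noncomputable def kactA : A →* Equiv.Perm ((C ⧸ K) × KH A K) :=
  @MulAction.toPermHom A ((C ⧸ K) × KH A K) _
    { smul := fun a p => (p.1, Coprod.inr (CoprodI.of (i := p.1) a) * p.2)
      one_smul := by
        rintro ⟨x, h⟩
        change (x, Coprod.inr (CoprodI.of (i := x) (1 : A)) * h) = (x, h)
        simp
      mul_smul := by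
        rintro a b ⟨x, h⟩
        change (x, Coprod.inr (CoprodI.of (i := x) (a * b)) * h) =
          (x, Coprod.inr (CoprodI.of (i := x) a) * (Coprod.inr (CoprodI.of (i := x) b) * h))
        rw [map_mul, map_mul, mul_assoc] }

lemma kactA_apply (a : A) (x : C ⧸ K) (h : KH A K) :
    kactA K a (x, h) = (x, Coprod.inr (CoprodI.of (i := x) a) * h) := rfl

/-- The induced action of the free product. -/
noncomputable def kact : Coprod A C →* Equiv.Perm ((C ⧸ K) × KH A K) :=
  Coprod.lift (kactA K) (kactC K)

/-- The embedding. -/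
noncomputable def kphi : KH A K →* Coprod A C :=
  Coprod.lift (Coprod.inr.comp K.subtype)
    (CoprodI.lift fun x => ((MulAut.conj (Coprod.inr (kt K x) : Coprod A C)⁻¹).toMonoidHom.comp
      Coprod.inl))

lemma kphi_inl (k : K) : kphi K (Coprod.inl k : KH A K) = Coprod.inr (k : C) := rfl

lemma kphi_of (x : C ⧸ K) (a : A) :
    kphi K (Coprod.inr (CoprodI.of (i := x) a) : KH A K) =
      (Coprod.inr (kt K x))⁻¹ * Coprod.inl a * Coprod.inr (kt K x) := by
  simp [kphi]

lemma kact_t (x : C ⧸ K) (h : KH A K) :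
    kact K (Coprod.inr (kt K x)) (((1 : C) : C ⧸ K), h) = (x, h) := by
  have h1 : kcoc K (kt K x) ((1 : C) : C ⧸ K) = 1 :=
    Subtype.ext (by simp only [kcoc, kt_smul_one, kt_one]; simp)
  simp only [kact, Coprod.lift_apply_inr, kactC_apply, h1, kt_smul_one, map_one, one_mul]

lemma kact_phi (h : KH A K) : ∀ h' : KH A K,
    kact K (kphi K h) (((1 : C) : C ⧸ K), h') = (((1 : C) : C ⧸ K), h * h') := by
  induction h using Coprod.induction_on with
  | inl k =>
    intro h'
    have h0 : (k : C) • ((1 : C) : C ⧸ K) = ((1 : C) : C ⧸ K) := by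
      rw [MulAction.Quotient.smul_coe]
      rw [QuotientGroup.eq]
      simp
    have h1 : kcoc K (k : C) ((1 : C) : C ⧸ K) = k :=
      Subtype.ext (by simp only [kcoc, h0, kt_one]; simp)
    simp only [kphi_inl, kact, Coprod.lift_apply_inr, kactC_apply, h1, h0]
  | inr m =>
    induction m using CoprodI.induction_on with
    | one => intro h'; simp
    | of x a =>
      intro h'
      rw [kphi_of, map_mul, map_mul, Equiv.Perm.mul_apply, Equiv.Perm.mul_apply, kact_t,
        map_inv, Equiv.Perm.inv_eq_iff_eq, kact_t]
      simp only [kact, Coprod.lift_apply_inl, kactA_apply]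
    | mul a b ha hb =>
      intro h'
      simp only [map_mul, Equiv.Perm.mul_apply, ha, hb, mul_assoc]
  | mul a b ha hb =>
    intro h'
    simp only [map_mul, Equiv.Perm.mul_apply, ha, hb, mul_assoc]

lemma kphi_injective : Function.Injective (kphi K : KH A K →* Coprod A C) := by
  intro a b hab
  have h1 := kact_phi K a 1
  rw [hab, kact_phi K b 1] at h1
  simpa using (congrArg Prod.snd h1).symm

lemma kphi_surj (g : Coprod A C) : ∀ x : C ⧸ K,
    (Coprod.inr (kt K (Coprod.snd g • x)))⁻¹ * g * Coprod.inr (kt K x) ∈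
      (kphi K : KH A K →* Coprod A C).range := by
  induction g using Coprod.induction_on with
  | inl a =>
    intro x
    exact ⟨Coprod.inr (CoprodI.of (i := x) a), by rw [kphi_of]; simp⟩
  | inr c =>
    intro x
    refine ⟨Coprod.inl (kcoc K c x), ?_⟩
    rw [kphi_inl]
    simp [kcoc, mul_assoc]
  | mul a b ha hb =>
    intro x
    have := mul_mem (ha (Coprod.snd b • x)) (hb x)
    rw [map_mul, mul_smul]
    convert this using 1
    group

lemma kphi_range : (kphi K : KH A K →* Coprod A C).range = K.comap Coprod.snd := by
  apply le_antisymm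
  · rintro _ ⟨h, rfl⟩
    rw [Subgroup.mem_comap]
    induction h using Coprod.induction_on with
    | inl k => rw [kphi_inl]; simp
    | inr m =>
      induction m using CoprodI.induction_on with
      | one => simp [one_mem]
      | of x a => rw [kphi_of]; simp [one_mem]
      | mul a b ha hb => rw [map_mul, map_mul, map_mul]; exact mul_mem ha hb
    | mul a b ha hb => rw [map_mul, map_mul]; exact mul_mem ha hb
  · intro g hg
    have hg' : Coprod.snd g ∈ K := hg
    have := kphi_surj K g ((1 : C) : C ⧸ K)
    have h0 : Coprod.snd g • ((1 : C) : C ⧸ K) = ((1 : C) : C ⧸ K) := by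
      rw [MulAction.Quotient.smul_coe, QuotientGroup.eq]
      simpa using hg'
    rw [h0, kt_one] at this
    simpa using this

/-- Kurosh for these subgroups. -/
noncomputable def kequiv : KH A K ≃* (K.comap (Coprod.snd : Coprod A C →* C)) :=
  (MonoidHom.ofInjective (kphi_injective K)).trans (MulEquiv.subgroupCongr (kphi_range K))

/-- Reindexing a free product of copies of the same group. -/
def kreindex {I J : Type} (e : I ≃ J) :
    CoprodI (fun _ : I => A) ≃* CoprodI (fun _ : J => A) :=
  MonoidHom.toMulEquiv
    (CoprodI.lift fun i => (CoprodI.of (M := fun _ : J => A) (i := e i)))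
    (CoprodI.lift fun j => (CoprodI.of (M := fun _ : I => A) (i := e.symm j)))
    (by
      ext i a
      simp only [MonoidHom.comp_apply, CoprodI.lift_of, MonoidHom.id_apply]
      rw [e.symm_apply_apply])
    (by
      ext i a
      simp only [MonoidHom.comp_apply, CoprodI.lift_of, MonoidHom.id_apply]
      rw [e.apply_symm_apply])

end Kurosh

lemma stmt_aux (q : ℕ) (hq : 3 ≤ q)
    (X : Subgroup (Coprod (Multiplicative (ZMod 2)) (Multiplicative (ZMod q)))) [hX : X.Normal]
    (d : ℕ) (hd : X.index = d) (hd0 : d ≠ 0)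
    (hS : Coprod.inl (Multiplicative.ofAdd (1 : ZMod 2)) ∈ X) :
    d ∣ q ∧
    Subgroup.zpowers ((QuotientGroup.mk' X) (Coprod.inr (Multiplicative.ofAdd (1 : ZMod q)))) = ⊤ ∧
    Nonempty (X ≃*
      Monoid.Coprod (Multiplicative (ZMod (q / d)))
        (Monoid.CoprodI (fun _ : Fin d => Multiplicative (ZMod 2)))) := by
  have : NeZero q := ⟨by omega⟩
  have hinl : ∀ a : Multiplicative (ZMod 2), Coprod.inl a ∈ X := by
    intro a
    have : a = 1 ∨ a = Multiplicative.ofAdd (1 : ZMod 2) := by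
      revert a; decide
    rcases this with rfl | rfl
    · simp [one_mem]
    · exact hS
  have hhom : ((QuotientGroup.mk' X).comp Coprod.inr).comp Coprod.snd = QuotientGroup.mk' X := by
    apply Coprod.hom_ext
    · refine MonoidHom.ext fun a => ?_
      simpa using ((QuotientGroup.eq_one_iff _).2 (hinl a)).symm
    · refine MonoidHom.ext fun c => ?_
      simp
  have hmk : ∀ g, QuotientGroup.mk' X (Coprod.inr (Coprod.snd g)) = QuotientGroup.mk' X g :=
    fun g => DFunLike.congr_fun hhom g
  obtain ⟨K, hK⟩ : ∃ K : Subgroup (Multiplicative (ZMod q)), K = X.comap Coprod.inr := ⟨_, rfl⟩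
  have hXK : X = K.comap Coprod.snd := by
    ext g
    rw [hK, Subgroup.mem_comap, Subgroup.mem_comap, ← QuotientGroup.eq_one_iff,
      ← QuotientGroup.eq_one_iff (N := X) (Coprod.inr (Coprod.snd g))]
    have := hmk g
    simp only [QuotientGroup.mk'_apply] at this
    rw [this]
  have hKi : K.index = d := by
    rw [← hd, hXK, Subgroup.index_comap_of_surjective _ Coprod.snd_surjective]
  have hcard : Nat.card K * d = q := by
    rw [← hKi, Subgroup.card_mul_index]; simp
  refine ⟨⟨_, by rw [mul_comm]; exact hcard.symm⟩, ?_, ?_⟩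
  · rw [eq_top_iff]
    rintro y -
    obtain ⟨g, rfl⟩ := QuotientGroup.mk'_surjective X y
    rw [← hmk g]
    obtain ⟨n, hn⟩ := ZMod.intCast_surjective (Multiplicative.toAdd (Coprod.snd g))
    refine ⟨n, ?_⟩
    have : Coprod.snd g = (Multiplicative.ofAdd (1 : ZMod q)) ^ n := by
      apply Multiplicative.toAdd.injective
      rw [← hn]; simp
    rw [this]
    simp
  · have hKc : Nat.card K = q / d := by
      exact (Nat.div_eq_of_eq_mul_left (Nat.pos_of_ne_zero hd0) hcard.symm).symm
    have e1 : K ≃* Multiplicative (ZMod (q / d)) :=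
      mulEquivOfCyclicCardEq (by rw [hKc]; exact (Nat.card_zmod _).symm)
    have e2 : (Multiplicative (ZMod q) ⧸ K) ≃ Fin d :=
      Finite.equivFinOfCardEq hKi
    exact ⟨(MulEquiv.subgroupCongr hXK).trans
      ((kequiv K).symm.trans (MulEquiv.coprodCongr e1 (kreindex e2)))⟩


/-- Lemma 9.1: a normal subgroup `X` of index `d` of `G_q = Z_2 * Z_q` containing `S` has
cyclic quotient generated by the image of `R` (so `d ∣ q`), and `X` is a free product of
`d` copies of `Z_2` if `d = q`, or of `Z_{q/d}` and `d` copies of `Z_2` if `d < q`. -/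
theorem stmt_17 (q : ℕ) (hq : 3 ≤ q) (X : Subgroup (Hecke q)) [hX : X.Normal]
    (d : ℕ) (hd : X.index = d) (hd0 : d ≠ 0) (hS : HS q ∈ X) :
    d ∣ q ∧
    Subgroup.zpowers ((QuotientGroup.mk' X) (HR q)) = ⊤ ∧
    (d = q → Nonempty (X ≃*
      Monoid.CoprodI (fun _ : Fin d => Multiplicative (ZMod 2)))) ∧
    (d ≠ q → Nonempty (X ≃*
      Monoid.Coprod (Multiplicative (ZMod (q / d)))
        (Monoid.CoprodI (fun _ : Fin d => Multiplicative (ZMod 2))))) := by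
  have key : d ∣ q ∧ Subgroup.zpowers ((QuotientGroup.mk' X) (HR q)) = ⊤ ∧
      Nonempty (X ≃* Monoid.Coprod (Multiplicative (ZMod (q / d)))
        (Monoid.CoprodI (fun _ : Fin d => Multiplicative (ZMod 2)))) :=
    @stmt_aux q hq X hX d hd hd0 hS
  obtain ⟨h1, h2, ⟨e⟩⟩ := key
  refine ⟨h1, h2, ?_, fun _ => ⟨e⟩⟩
  intro hdq
  have h3 : q / d = 1 := by rw [hdq]; exact Nat.div_self (by omega)
  rw [h3] at e
  have e3 : Multiplicative (ZMod 1) ≃* PUnit.{1} :=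
    { toFun := fun _ => PUnit.unit
      invFun := fun _ => 1
      left_inv := fun _ => Subsingleton.elim _ _
      right_inv := fun _ => rfl
      map_mul' := fun _ _ => rfl }
  exact ⟨(e.trans (MulEquiv.coprodCongr e3 (MulEquiv.refl _))).trans (MulEquiv.punitCoprod _)⟩
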